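/- arXiv:2405.12831 — 12 statements merged into one kernel-verified Lean document; each statement's English description precedes it below -/
import Mathlib

section
/- Let C, u, v ∈ EuclideanSpace ℝ (Fin 3) with ‖C‖ = 1, ‖u‖ = ‖v‖ = 1 and ⟨u, v⟩ = 0. Regard u, v as constant vector fields and let ∇ be the connection (∇_X Y)(p) = (fderiv ℝ Y p)(X(p)) + ⟨C, Y(p)⟩ • X(p), with curvature R(X,Y)Z = ∇_X ∇_Y Z − ∇_Y ∇_X Z (for constant commuting fields). Then at every point the sectional curvature K̃ = (⟨R(u,v)v, u⟩ + ⟨R(v,u)u, v⟩)/2 equals (⟨u,C⟩² + ⟨v,C⟩²)/2; moreover 0 ≤ K̃ ≤ 1/2, K̃ = 0 if and only if ⟨u,C⟩ = 0 and ⟨v,C⟩ = 0 (the plane span{u,v} is perpendicular to C), and K̃ = 1/2 if and only if C ∈ span{u,v} (the plane is parallel to C). -/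
open scoped RealInnerProductSpace

/-- The canonical semi-symmetric non-metric connection on `ℝ³` determined by a vector
field `C`, acting on vector fields (maps `ℝ³ → ℝ³`):
`(∇_X Y)(p) = (D_X Y)(p) + ⟨C, Y(p)⟩ • X(p)`, where `D` is the flat connection. -/
noncomputable def snmConn (C : EuclideanSpace ℝ (Fin 3))
    (X Y : EuclideanSpace ℝ (Fin 3) → EuclideanSpace ℝ (Fin 3)) :
    EuclideanSpace ℝ (Fin 3) → EuclideanSpace ℝ (Fin 3) :=
  fun p => fderiv ℝ Y p (X p) + ⟪C, Y p⟫ • X p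

/-- The curvature `R(X,Y)Z = ∇_X ∇_Y Z − ∇_Y ∇_X Z` of the canonical semi-symmetric
non-metric connection, for constant (hence commuting) vector fields `X, Y, Z`. -/
noncomputable def snmCurv (C X Y Z : EuclideanSpace ℝ (Fin 3)) :
    EuclideanSpace ℝ (Fin 3) → EuclideanSpace ℝ (Fin 3) :=
  fun p => snmConn C (fun _ => X) (snmConn C (fun _ => Y) (fun _ => Z)) p
    - snmConn C (fun _ => Y) (snmConn C (fun _ => X) (fun _ => Z)) p

theorem snmCurv_apply (C X Y Z p : EuclideanSpace ℝ (Fin 3)) :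
    snmCurv C X Y Z p = (⟪C, Z⟫ * ⟪C, Y⟫) • X - (⟪C, Z⟫ * ⟪C, X⟫) • Y := by
  have hconst (X : EuclideanSpace ℝ (Fin 3)) :
      snmConn C (fun _ => X) (fun _ => Z) = fun _ => ⟪C, Z⟫ • X := by
    funext q
    simp [snmConn]
  simp only [snmCurv, hconst]
  simp [snmConn, inner_smul_right]

/-- For an orthonormal pair, the squared distance from `C` to its orthogonal projection onto the
spanned plane is given by Pythagoras. -/
theorem norm_sub_proj_pair_sq {E : Type*} [NormedAddCommGroup E] [InnerProductSpace ℝ E]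
    {C u v : E} (hu : ‖u‖ = 1) (hv : ‖v‖ = 1) (huv : ⟪u, v⟫ = 0) :
    ‖C - (⟪u, C⟫ • u + ⟪v, C⟫ • v)‖ ^ 2 = ‖C‖ ^ 2 - (⟪u, C⟫ ^ 2 + ⟪v, C⟫ ^ 2) := by
  rw [norm_sub_sq_real, norm_add_sq_real]
  simp only [norm_smul, inner_add_right, inner_smul_left, inner_smul_right, hu, hv, huv,
    real_inner_comm u C, real_inner_comm v C, mul_pow, Real.norm_eq_abs, sq_abs]
  simp
  ring

/-- Membership in the plane spanned by an orthonormal pair is equality in Bessel's inequality. -/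
theorem mem_span_pair_iff_inner_sq_add_inner_sq {E : Type*} [NormedAddCommGroup E]
    [InnerProductSpace ℝ E] {C u v : E} (hu : ‖u‖ = 1) (hv : ‖v‖ = 1) (huv : ⟪u, v⟫ = 0) :
    C ∈ Submodule.span ℝ ({u, v} : Set E) ↔ ⟪u, C⟫ ^ 2 + ⟪v, C⟫ ^ 2 = ‖C‖ ^ 2 := by
  have hvu : ⟪v, u⟫ = 0 := by rw [real_inner_comm, huv]
  have hproj := norm_sub_proj_pair_sq (C := C) hu hv huv
  rw [Submodule.mem_span_pair]
  constructor
  · rintro ⟨a, b, rfl⟩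
    have hzero : a • u + b • v - (⟪u, a • u + b • v⟫ • u + ⟪v, a • u + b • v⟫ • v) = 0 := by
      simp [inner_add_right, inner_smul_right, hu, hv, huv, hvu]
    rw [hzero, norm_zero] at hproj
    linarith
  · intro h
    rw [h, sub_self, sq_eq_zero_iff, norm_eq_zero, sub_eq_zero] at hproj
    exact ⟨_, _, hproj.symm⟩

theorem sectional_curvature_of_plane_wrt_canonical_snm_connection
    (C u v : EuclideanSpace ℝ (Fin 3)) (hC : ‖C‖ = 1)
    (hu : ‖u‖ = 1) (hv : ‖v‖ = 1) (huv : ⟪u, v⟫ = 0)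
    (p : EuclideanSpace ℝ (Fin 3)) :
    (⟪snmCurv C u v v p, u⟫ + ⟪snmCurv C v u u p, v⟫) / 2
        = (⟪u, C⟫ ^ 2 + ⟪v, C⟫ ^ 2) / 2 ∧
      0 ≤ (⟪snmCurv C u v v p, u⟫ + ⟪snmCurv C v u u p, v⟫) / 2 ∧
      (⟪snmCurv C u v v p, u⟫ + ⟪snmCurv C v u u p, v⟫) / 2 ≤ 1 / 2 ∧
      ((⟪snmCurv C u v v p, u⟫ + ⟪snmCurv C v u u p, v⟫) / 2 = 0 ↔
        ⟪u, C⟫ = 0 ∧ ⟪v, C⟫ = 0) ∧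
      ((⟪snmCurv C u v v p, u⟫ + ⟪snmCurv C v u u p, v⟫) / 2 = 1 / 2 ↔
        C ∈ Submodule.span ℝ ({u, v} : Set (EuclideanSpace ℝ (Fin 3)))) := by
  have hvu : ⟪v, u⟫ = 0 := by rw [real_inner_comm, huv]
  have hK : (⟪snmCurv C u v v p, u⟫ + ⟪snmCurv C v u u p, v⟫) / 2
      = (⟪u, C⟫ ^ 2 + ⟪v, C⟫ ^ 2) / 2 := by
    simp only [snmCurv_apply, inner_sub_left, real_inner_smul_left, real_inner_self_eq_norm_sq,
      hu, hv, huv, hvu, real_inner_comm u C, real_inner_comm v C]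
    ring
  have hproj := norm_sub_proj_pair_sq (C := C) hu hv huv
  rw [hC] at hproj
  rw [hK, mem_span_pair_iff_inner_sq_add_inner_sq hu hv huv, hC]
  refine ⟨rfl, by positivity, ?_, ⟨fun h => ?_, ?_⟩, ?_⟩
  · linarith [sq_nonneg ‖C - (⟪u, C⟫ • u + ⟪v, C⟫ • v)‖]
  · constructor <;> nlinarith [sq_nonneg ⟪u, C⟫, sq_nonneg ⟪v, C⟫]
  · rintro ⟨h₁, h₂⟩
    simp [h₁, h₂]
  · constructor <;> intro h <;> linarith
end

section
/- Let c ∈ ℝ with c ≠ 0 and c ≠ 1/2. Define f(x) = −(1/c)·log(cos(c x)) and g(y) = −((2c−1)/c)·log(cos(c y/(2c−1))). Then for all x with cos(c x) > 0 and all y with cos(c y/(2c−1)) > 0, the identity 2 f''(x) g''(y) = f''(x)(1 + g'(y)²) + g''(y)(1 + f'(x)²) holds (where f', f'', g', g'' denote first and second derivatives). -/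
open Real

theorem hasDerivAt_neg_inv_mul_log_cos {k t : ℝ} (hk : k ≠ 0) (ht : cos (k * t) ≠ 0) :
    HasDerivAt (fun s => -(1 / k) * log (cos (k * s))) (tan (k * t)) t := by
  have h := ((((hasDerivAt_id t).const_mul k).cos).log ht).const_mul (-(1 / k))
  refine h.congr_deriv ?_
  simp only [id, tan_eq_sin_div_cos]
  field_simp

theorem deriv_deriv_neg_inv_mul_log_cos {k t : ℝ} (hk : k ≠ 0) (ht : cos (k * t) ≠ 0) :
    deriv (deriv fun s => -(1 / k) * log (cos (k * s))) t = k * (1 + tan (k * t) ^ 2) := by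
  have hev : (deriv fun s => -(1 / k) * log (cos (k * s))) =ᶠ[nhds t] fun s => tan (k * s) := by
    have hcont : ContinuousAt (fun s => cos (k * s)) t := by fun_prop
    filter_upwards [hcont.eventually_ne ht] with s hs
    exact (hasDerivAt_neg_inv_mul_log_cos hk hs).deriv
  rw [hev.deriv_eq]
  have h := (hasDerivAt_tan ht).comp t ((hasDerivAt_id t).const_mul k)
  refine h.deriv.trans ?_
  rw [← inv_one_add_tan_sq ht]
  simp [mul_comm]

theorem separated_solution_satisfies_equation (c : ℝ) (hc : c ≠ 0) (hc' : c ≠ 1 / 2)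
    (f g : ℝ → ℝ)
    (hf : f = fun x => -(1 / c) * Real.log (Real.cos (c * x)))
    (hg : g = fun y => -((2 * c - 1) / c) * Real.log (Real.cos (c * y / (2 * c - 1)))) :
    ∀ x y : ℝ, 0 < Real.cos (c * x) → 0 < Real.cos (c * y / (2 * c - 1)) →
      2 * deriv (deriv f) x * deriv (deriv g) y =
        deriv (deriv f) x * (1 + (deriv g y) ^ 2)
          + deriv (deriv g) y * (1 + (deriv f x) ^ 2) := by
  intro x y hx hy
  have hd : 2 * c - 1 ≠ 0 := fun h => hc' (by linarith)
  obtain ⟨k, hk⟩ : ∃ k, k = c / (2 * c - 1) := ⟨_, rfl⟩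
  have hk0 : k ≠ 0 := hk ▸ div_ne_zero hc hd
  have hg' : g = fun s => -(1 / k) * log (cos (k * s)) := by
    rw [hg, hk]
    funext s
    rw [one_div_div, mul_div_right_comm]
  have hy' : cos (k * y) ≠ 0 := by
    rw [hk, ← mul_div_right_comm]
    exact hy.ne'
  have hck : 2 * c * k = c + k := by
    rw [hk]
    field_simp
    ring
  rw [hf, hg', deriv_deriv_neg_inv_mul_log_cos hc hx.ne',
    deriv_deriv_neg_inv_mul_log_cos hk0 hy',
    (hasDerivAt_neg_inv_mul_log_cos hc hx.ne').deriv,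
    (hasDerivAt_neg_inv_mul_log_cos hk0 hy').deriv]
  linear_combination (1 + tan (c * x) ^ 2) * (1 + tan (k * y) ^ 2) * hck
end

section
/- Let K > 0 and set a = √(2K). Define z : ℝ → ℝ by z(s) = −log(cosh(a s)). Then for all s ∈ ℝ, z''(s) = z'(s)² − 2K (equivalently (z'(s)² − z''(s))/2 = K); moreover, if K ≤ 1/2 then z'(s)² < 1 for all s, so that x with x'(s) = √(1 − z'(s)²) makes (x(s), z(s)) a unit-speed plane curve. -/
theorem hasDerivAt_neg_log_cosh_mul (a s : ℝ) :
    HasDerivAt (fun s => -Real.log (Real.cosh (a * s)))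
      (-(a * Real.sinh (a * s) / Real.cosh (a * s))) s := by
  refine ((((hasDerivAt_id s).const_mul a).cosh).log (Real.cosh_pos _).ne').neg.congr_deriv ?_
  simp only [id, mul_one]
  ring

theorem hasDerivAt_neg_mul_sinh_div_cosh (a s : ℝ) :
    HasDerivAt (fun s => -(a * Real.sinh (a * s) / Real.cosh (a * s)))
      (-(a ^ 2 / Real.cosh (a * s) ^ 2)) s := by
  have hmul := (hasDerivAt_id s).const_mul a
  refine ((hmul.sinh.const_mul a).div hmul.cosh (Real.cosh_pos _).ne').neg.congr_deriv ?_
  simp only [id, mul_one]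
  congr 2
  linear_combination a ^ 2 * Real.cosh_sq (a * s)

theorem cylindrical_surface_positive_curvature (K : ℝ) (hK : 0 < K)
    (a : ℝ) (ha : a = Real.sqrt (2 * K)) (z : ℝ → ℝ)
    (hz : z = fun s => -Real.log (Real.cosh (a * s))) :
    (∀ s : ℝ, deriv (deriv z) s = (deriv z s) ^ 2 - 2 * K) ∧
      (K ≤ 1 / 2 → ∀ s : ℝ, (deriv z s) ^ 2 < 1) := by
  have ha2 : a ^ 2 = 2 * K := by rw [ha, Real.sq_sqrt (by positivity)]
  have hd : deriv z = fun s => -(a * Real.sinh (a * s) / Real.cosh (a * s)) := by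
    rw [hz]
    exact funext fun s => (hasDerivAt_neg_log_cosh_mul a s).deriv
  rw [hd]
  refine ⟨fun s => ?_, fun hK1 s => ?_⟩
  · rw [(hasDerivAt_neg_mul_sinh_div_cosh a s).deriv, ← ha2]
    have := (Real.cosh_pos (a * s)).ne'
    field_simp
    linear_combination a ^ 2 * Real.cosh_sq (a * s)
  · rw [neg_sq, div_pow, div_lt_one (pow_pos (Real.cosh_pos _) 2), mul_pow, ha2, Real.cosh_sq]
    nlinarith [sq_nonneg (Real.sinh (a * s))]
end

section
/- Define, for s ∈ (0, π/4), x(s) = √2·arcsin(√2·sin s) − arctan(sin s/√(cos(2s))) and z(s) = −log(cos s). Then for all s ∈ (0, π/4): x'(s) = √(cos(2s))/cos s > 0, x'(s)² + z'(s)² = 1 (the curve γ(s) = (x(s), 0, z(s)) is parametrized by arc length), and (z'(s)² − z''(s))/2 = −1/2. -/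
open Real in
/-- The derivative of the height `-log (cos s)` is `tan s`, written as `sin s / cos s`. -/
theorem hasDerivAt_neg_log_cos {s : ℝ} (hc : cos s ≠ 0) :
    HasDerivAt (fun s => -log (cos s)) (sin s / cos s) s := by
  refine ((hasDerivAt_cos s).log hc).neg.congr_deriv ?_
  ring

open Real in
theorem hasDerivAt_sqrt_two_mul_arcsin_sub_arctan {s : ℝ} (hc : 0 < cos s)
    (hd : 0 < cos (2 * s)) :
    HasDerivAt (fun s => √2 * arcsin (√2 * sin s) - arctan (sin s / √(cos (2 * s))))
      (√(cos (2 * s)) / cos s) s := by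
  have hr : 0 < √(cos (2 * s)) := sqrt_pos.2 hd
  have hr2 : √(cos (2 * s)) ^ 2 = cos (2 * s) := sq_sqrt hd.le
  have h2 : √2 ^ 2 = (2 : ℝ) := sq_sqrt zero_le_two
  have hcos := cos_two_mul s
  have hsq := sin_sq_add_cos_sq s
  have harg : 1 - (√2 * sin s) ^ 2 = cos (2 * s) := by
    rw [mul_pow, h2]
    linarith
  have hne1 : √2 * sin s ≠ -1 := fun h => by
    rw [h] at harg
    linarith
  have hne2 : √2 * sin s ≠ 1 := fun h => by
    rw [h] at harg
    linarith
  have harcsin : HasDerivAt (fun s => √2 * arcsin (√2 * sin s))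
      (2 * cos s / √(cos (2 * s))) s := by
    refine (((hasDerivAt_arcsin hne1 hne2).comp s
      ((hasDerivAt_sin s).const_mul √2)).const_mul √2).congr_deriv ?_
    rw [harg]
    linear_combination (cos s / √(cos (2 * s))) * h2
  have hsqrt : HasDerivAt (fun s => √(cos (2 * s)))
      (-sin (2 * s) / √(cos (2 * s))) s := by
    refine (((hasDerivAt_id' s).const_mul 2).cos.sqrt hd.ne').congr_deriv ?_
    field_simp
  have harctan : HasDerivAt (fun s => arctan (sin s / √(cos (2 * s))))
      (1 / (√(cos (2 * s)) * cos s)) s := by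
    refine ((hasDerivAt_sin s).div hsqrt hr.ne').arctan.congr_deriv ?_
    have hden : 1 + (sin s / √(cos (2 * s))) ^ 2 = cos s ^ 2 / √(cos (2 * s)) ^ 2 := by
      field_simp
      linarith
    have hnum : cos s * √(cos (2 * s)) - sin s * (-sin (2 * s) / √(cos (2 * s)))
        = cos s / √(cos (2 * s)) := by
      rw [sin_two_mul]
      field_simp
      linear_combination hr2 + hcos + 2 * hsq
    simp only [Pi.div_apply]
    rw [hden, hnum]
    field_simp
  refine (harcsin.sub harctan).congr_deriv ?_
  field_simp
  linarith

theorem cylinder_with_curvature_neg_one_half (x z : ℝ → ℝ)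
    (hx : x = fun s => Real.sqrt 2 * Real.arcsin (Real.sqrt 2 * Real.sin s)
      - Real.arctan (Real.sin s / Real.sqrt (Real.cos (2 * s))))
    (hz : z = fun s => -Real.log (Real.cos s)) :
    ∀ s ∈ Set.Ioo 0 (Real.pi / 4),
      deriv x s = Real.sqrt (Real.cos (2 * s)) / Real.cos s ∧
      0 < deriv x s ∧
      (deriv x s) ^ 2 + (deriv z s) ^ 2 = 1 ∧
      ((deriv z s) ^ 2 - deriv (deriv z) s) / 2 = -(1 / 2) := by
  rintro s ⟨hs0, hs1⟩
  have hc : 0 < Real.cos s := Real.cos_pos_of_mem_Ioo ⟨by linarith, by linarith⟩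
  have hd : 0 < Real.cos (2 * s) := Real.cos_pos_of_mem_Ioo ⟨by linarith, by linarith⟩
  have hsq := Real.sin_sq_add_cos_sq s
  have hx' : deriv x s = Real.sqrt (Real.cos (2 * s)) / Real.cos s := by
    rw [hx]
    exact (hasDerivAt_sqrt_two_mul_arcsin_sub_arctan hc hd).deriv
  have hz' : deriv z s = Real.sin s / Real.cos s := by
    rw [hz]
    exact (hasDerivAt_neg_log_cos hc.ne').deriv
  have hz'' : deriv (deriv z) s = 1 / Real.cos s ^ 2 := by
    have hev : deriv z =ᶠ[nhds s] Real.tan := by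
      filter_upwards [Real.continuous_cos.continuousAt.eventually_ne hc.ne'] with t ht
      rw [hz, (hasDerivAt_neg_log_cos ht).deriv, Real.tan_eq_sin_div_cos]
    rw [hev.deriv_eq, Real.deriv_tan]
  refine ⟨hx', hx' ▸ div_pos (Real.sqrt_pos.2 hd) hc, ?_, ?_⟩
  · rw [hx', hz', div_pow, div_pow, Real.sq_sqrt hd.le, Real.cos_two_mul]
    field_simp
    linarith
  · rw [hz', hz'']
    field_simp
    linarith
end

section
/- Let I ⊆ ℝ be a nonempty open interval and x, z : ℝ → ℝ be twice differentiable on I with x(s) > 0 and x'(s)² + z'(s)² = 1 for all s ∈ I. Let a, b, c ∈ ℝ with a² + b² + c² = 1, and set κ = x'z'' − z'x'', G = z'κ/x, H = (z' + xκ)/(2x). Suppose there exists K ∈ ℝ such that for all s ∈ I and all t ∈ ℝ: (1/2)·((b·cos t − a·sin t)² + (x'(s)·(a·cos t + b·sin t) + c·z'(s))²) + G(s) − (c·x'(s) − z'(s)·(a·cos t + b·sin t))·H(s) = K. Then either z'(s) = 0 for all s ∈ I (the surface is a horizontal plane), in which case K = (a² + b²)/2, or a = 0 and b = 0 (the rotation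 axis is parallel to C). -/
open Real

/-- If the even part in `(cos t, sin t)` of a trigonometric polynomial of the shape of the sectional
curvature is constant, then the coefficient `1 - p ^ 2` or the vector `(a, b)` vanishes. -/
theorem sq_eq_one_or_eq_zero_of_trig_const {a b p q e f K : ℝ}
    (h : ∀ t : ℝ, (1 / 2) * ((b * cos t - a * sin t) ^ 2
      + (p * (a * cos t + b * sin t) + q) ^ 2) + e + f * (a * cos t + b * sin t) = K) :
    p ^ 2 = 1 ∨ (a = 0 ∧ b = 0) := by
  have even (t : ℝ) : (b * cos t - a * sin t) ^ 2 + p ^ 2 * (a * cos t + b * sin t) ^ 2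
      = 2 * K - 2 * e - q ^ 2 := by
    have h₁ := h t
    have h₂ := h (t + π)
    rw [cos_add_pi, sin_add_pi] at h₂
    linear_combination h₁ + h₂
  have h₀ := even 0
  have h₁ := even (π / 2)
  have h₂ := even (π / 4)
  simp only [cos_zero, sin_zero, cos_pi_div_two, sin_pi_div_two, cos_pi_div_four,
    sin_pi_div_four] at h₀ h₁ h₂
  have hsqrt : √(2 : ℝ) ^ 2 = 2 := sq_sqrt (by norm_num)
  have hdiff : (p ^ 2 - 1) * (a ^ 2 - b ^ 2) = 0 := by linear_combination h₀ - h₁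
  have hmul : (p ^ 2 - 1) * (a * b) = 0 := by
    linear_combination h₂ - (h₀ + h₁) / 2
      - ((b - a) ^ 2 + p ^ 2 * (a + b) ^ 2) / 4 * hsqrt
  by_cases hp : p ^ 2 - 1 = 0
  · exact Or.inl (by linarith)
  · have hd := (mul_eq_zero.mp hdiff).resolve_left hp
    have hm := (mul_eq_zero.mp hmul).resolve_left hp
    rcases mul_eq_zero.mp hm with ha | hb
    · exact Or.inr ⟨ha, by simpa [ha] using hd⟩
    · exact Or.inr ⟨by simpa [hb] using hd, hb⟩

theorem rotational_axis_parallel_to_C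
    (a b c : ℝ) (habc : a ^ 2 + b ^ 2 + c ^ 2 = 1)
    (I : Set ℝ) (hI : ∃ p q : ℝ, p < q ∧ I = Set.Ioo p q)
    (x z : ℝ → ℝ)
    (hx : ∀ s ∈ I, DifferentiableAt ℝ x s ∧ DifferentiableAt ℝ (deriv x) s)
    (hz : ∀ s ∈ I, DifferentiableAt ℝ z s ∧ DifferentiableAt ℝ (deriv z) s)
    (hxpos : ∀ s ∈ I, 0 < x s)
    (hunit : ∀ s ∈ I, (deriv x s) ^ 2 + (deriv z s) ^ 2 = 1)
    (κ G H : ℝ → ℝ)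
    (hκ : ∀ s ∈ I, κ s = deriv x s * deriv (deriv z) s - deriv z s * deriv (deriv x) s)
    (hG : ∀ s ∈ I, G s = deriv z s * κ s / x s)
    (hH : ∀ s ∈ I, H s = (deriv z s + x s * κ s) / (2 * x s))
    (K : ℝ)
    (hK : ∀ s ∈ I, ∀ t : ℝ,
      (1 / 2) * ((b * Real.cos t - a * Real.sin t) ^ 2
          + (deriv x s * (a * Real.cos t + b * Real.sin t) + c * deriv z s) ^ 2)
        + G s
        - (c * deriv x s - deriv z s * (a * Real.cos t + b * Real.sin t)) * H s = K) :
    ((∀ s ∈ I, deriv z s = 0) ∧ K = (a ^ 2 + b ^ 2) / 2) ∨ (a = 0 ∧ b = 0) := by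
  by_cases hab : a = 0 ∧ b = 0
  · exact Or.inr hab
  have hz' : ∀ s ∈ I, deriv z s = 0 := by
    intro s hs
    have hp : deriv x s ^ 2 = 1 :=
      (sq_eq_one_or_eq_zero_of_trig_const (a := a) (b := b) (q := c * deriv z s)
        (e := G s - c * deriv x s * H s) (f := deriv z s * H s) (K := K) fun t => by
          linear_combination hK s hs t).resolve_right hab
    exact pow_eq_zero_iff (two_ne_zero) |>.mp (by linarith [hunit s hs])
  refine Or.inl ⟨hz', ?_⟩
  obtain ⟨p, q, hpq, rfl⟩ := hI
  obtain ⟨s, hs⟩ := Set.nonempty_Ioo.mpr hpq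
  have hz'' : deriv (deriv z) s = 0 := by
    have hev : deriv z =ᶠ[nhds s] fun _ => 0 :=
      Filter.eventually_of_mem (isOpen_Ioo.mem_nhds hs) hz'
    rw [hev.deriv_eq, deriv_const]
  have hκs : κ s = 0 := by simp [hκ s hs, hz' s hs, hz'']
  have hGs : G s = 0 := by simp [hG s hs, hκs]
  have hHs : H s = 0 := by simp [hH s hs, hκs, hz' s hs]
  have hK₀ := hK s hs 0
  have hu := hunit s hs
  simp only [hGs, hHs, hz' s hs, cos_zero, sin_zero] at hK₀ hu
  linear_combination -hK₀ + a ^ 2 / 2 * hu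
end

section
/- Let I ⊆ ℝ be a nonempty open interval and x, z : ℝ → ℝ be twice differentiable on I with x(s) > 0 and x'(s)² + z'(s)² = 1 for all s ∈ I. Set κ = x'z'' − z'x''. Suppose there exists K ∈ ℝ such that 2K·x(s) = (2z'(s) − x(s)x'(s))·κ(s) + z'(s)·(x(s)z'(s) − x'(s)) for all s ∈ I. Then it is not the case that 2z'(s) − x(s)x'(s) = 0 for all s ∈ I, and it is not the case that x(s)z'(s) − x'(s) = 0 for all s ∈ I. -/
/-- Two functions that agree on an open set have the same derivative there. -/
lemma IsOpen.hasDerivAt_unique_of_eqOn {U : Set ℝ} (hU : IsOpen U) {f g : ℝ → ℝ}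
    (h : ∀ s ∈ U, f s = g s) {s f' g' : ℝ} (hs : s ∈ U)
    (hf : HasDerivAt f f' s) (hg : HasDerivAt g g' s) : f' = g' :=
  hf.unique (hg.congr_of_eventuallyEq (Filter.eventually_of_mem (hU.mem_nhds hs) h))


theorem factors_cannot_vanish_identically
    (I : Set ℝ) (hI : ∃ p q : ℝ, p < q ∧ I = Set.Ioo p q)
    (x z : ℝ → ℝ)
    (hx : ∀ s ∈ I, DifferentiableAt ℝ x s ∧ DifferentiableAt ℝ (deriv x) s)
    (hz : ∀ s ∈ I, DifferentiableAt ℝ z s ∧ DifferentiableAt ℝ (deriv z) s)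
    (hxpos : ∀ s ∈ I, 0 < x s)
    (hunit : ∀ s ∈ I, (deriv x s) ^ 2 + (deriv z s) ^ 2 = 1)
    (κ : ℝ → ℝ)
    (hκ : ∀ s ∈ I, κ s = deriv x s * deriv (deriv z) s - deriv z s * deriv (deriv x) s)
    (K : ℝ)
    (hK : ∀ s ∈ I, 2 * K * x s =
      (2 * deriv z s - x s * deriv x s) * κ s
        + deriv z s * (x s * deriv z s - deriv x s)) :
    ¬ (∀ s ∈ I, 2 * deriv z s - x s * deriv x s = 0) ∧
      ¬ (∀ s ∈ I, x s * deriv z s - deriv x s = 0) := by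
  obtain ⟨p, q, hpq, rfl⟩ := hI
  obtain ⟨s₀, hs₀⟩ := Set.nonempty_Ioo.mpr hpq
  have hd : ∀ s ∈ Set.Ioo p q, HasDerivAt (fun t => x t ^ 2) (2 * x s * deriv x s) s := by
    intro s hs
    simpa using (hx s hs).1.hasDerivAt.fun_pow 2
  constructor
  · intro h
    have hconst : ∀ s ∈ Set.Ioo p q, (2 * K - 1) * x s ^ 2 = -2 - 8 * K := by
      intro s hs
      have hb : deriv z s = x s * deriv x s / 2 := by linarith [h s hs]
      have hu := hunit s hs
      have hk := hK s hs
      rw [h s hs] at hk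
      rw [hb] at hu hk
      have hk' : 2 * K = deriv x s ^ 2 * (x s ^ 2 - 2) / 4 := by
        apply mul_right_cancel₀ (hxpos s hs).ne'
        linear_combination hk
      linear_combination (4 + x s ^ 2) * hk' + (x s ^ 2 - 2) * hu
    have hder := isOpen_Ioo.hasDerivAt_unique_of_eqOn hconst hs₀
      ((hd s₀ hs₀).const_mul (2 * K - 1)) (hasDerivAt_const s₀ (-2 - 8 * K))
    have hxp := hxpos s₀ hs₀
    have hu := hunit s₀ hs₀
    have hc := hconst s₀ hs₀
    have h0 := h s₀ hs₀
    rcases mul_eq_zero.mp hder with hK0 | hxa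
    · rw [hK0] at hc
      linarith
    · have ha : deriv x s₀ = 0 := by
        rcases mul_eq_zero.mp hxa with h1 | h1
        · linarith
        · exact h1
      have hb : deriv z s₀ = 0 := by
        rw [ha] at h0
        linarith
      rw [ha, hb] at hu
      norm_num at hu
  · intro h
    have ha : ∀ s ∈ Set.Ioo p q, deriv x s = x s * deriv z s := fun s hs => by
      linarith [h s hs]
    have hb : ∀ s ∈ Set.Ioo p q, deriv z s ^ 2 * (1 + x s ^ 2) = 1 := by
      intro s hs
      have hu := hunit s hs
      rw [ha s hs] at hu
      linear_combination hu
    have hne : ∀ s ∈ Set.Ioo p q, 2 * x s * deriv x s ≠ 0 := by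
      intro s hs h0
      have hxp := hxpos s hs
      have hz0 : deriv z s ≠ 0 := by
        intro hz0
        have hbs := hb s hs
        rw [hz0] at hbs
        norm_num at hbs
      rw [ha s hs] at h0
      exact mul_ne_zero (by positivity) (mul_ne_zero hxp.ne' hz0) h0
    have hpoly : ∀ s ∈ Set.Ioo p q, 2 * K * (1 + x s ^ 2) ^ 2 = x s ^ 2 - 2 := by
      intro s hs
      have ha' : deriv (deriv x) s = deriv x s * deriv z s + x s * deriv (deriv z) s :=
        isOpen_Ioo.hasDerivAt_unique_of_eqOn ha hs (hx s hs).2.hasDerivAt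
          ((hx s hs).1.hasDerivAt.mul (hz s hs).2.hasDerivAt)
      have hk := hK s hs
      rw [h s hs, hκ s hs, ha', ha s hs] at hk
      have hk' : 2 * K = (x s ^ 2 - 2) * (deriv z s ^ 2) ^ 2 := by
        apply mul_right_cancel₀ (hxpos s hs).ne'
        linear_combination hk
      linear_combination (1 + x s ^ 2) ^ 2 * hk' +
        (x s ^ 2 - 2) * (deriv z s ^ 2 * (1 + x s ^ 2) + 1) * hb s hs
    have hlin : ∀ s ∈ Set.Ioo p q, 4 * K * (1 + x s ^ 2) = 1 := by
      intro s hs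
      have hder := isOpen_Ioo.hasDerivAt_unique_of_eqOn hpoly hs
        ((((hd s hs).const_add 1).pow 2).const_mul (2 * K)) ((hd s hs).sub_const 2)
      apply mul_right_cancel₀ (hne s hs)
      norm_num at hder
      linear_combination hder
    have hder := isOpen_Ioo.hasDerivAt_unique_of_eqOn hlin hs₀
      (((hd s₀ hs₀).const_add 1).const_mul (4 * K)) (hasDerivAt_const s₀ 1)
    have hc := hlin s₀ hs₀
    rw [(mul_eq_zero.mp hder).resolve_right (hne s₀ hs₀)] at hc
    norm_num at hc
end

section
/- Let c₁, c₂, θ ∈ ℝ and define x(s) = c₁ + s·cos θ, z(s) = c₂ + s·sin θ. Let I ⊆ ℝ be a nonempty open interval with x(s) > 0 for all s ∈ I, and suppose there exists K ∈ ℝ such that 2K·(c₁ + s·cos θ) = sin θ·((c₁ + s·cos θ)·sin θ − cos θ) for all s ∈ I. Then either cos θ = 0 and K = 1/2, or sin θ = 0 and K = 0. -/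
theorem conical_rotational_surface_classification
    (c₁ c₂ θ : ℝ) (x z : ℝ → ℝ)
    (hx : x = fun s => c₁ + s * Real.cos θ)
    (hz : z = fun s => c₂ + s * Real.sin θ)
    (I : Set ℝ) (hI : ∃ p q : ℝ, p < q ∧ I = Set.Ioo p q)
    (hxpos : ∀ s ∈ I, 0 < x s)
    (K : ℝ)
    (hK : ∀ s ∈ I, 2 * K * (c₁ + s * Real.cos θ) =
      Real.sin θ * ((c₁ + s * Real.cos θ) * Real.sin θ - Real.cos θ)) :
    (Real.cos θ = 0 ∧ K = 1 / 2) ∨ (Real.sin θ = 0 ∧ K = 0) := by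
  obtain ⟨p, q, hpq, rfl⟩ := hI
  obtain ⟨s, hps, hsq⟩ := exists_between hpq
  obtain ⟨t, hst, htq⟩ := exists_between hsq
  have hs : s ∈ Set.Ioo p q := ⟨hps, hsq⟩
  have ht : t ∈ Set.Ioo p q := ⟨hps.trans hst, htq⟩
  have hpos := hxpos s hs
  simp only [hx] at hpos
  have hKs := hK s hs
  have hKt := hK t ht
  have hsc := Real.sin_sq_add_cos_sq θ
  by_cases hcos : Real.cos θ = 0
  · left
    refine ⟨hcos, ?_⟩
    simp only [hcos, mul_zero, add_zero, sub_zero] at hpos hKs hsc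
    have h : c₁ * (2 * K - 1) = 0 := by linear_combination hKs + c₁ * hsc
    have := (mul_eq_zero.mp h).resolve_left hpos.ne'
    linarith
  · right
    have h : ((t - s) * Real.cos θ) * (2 * K - Real.sin θ ^ 2) = 0 := by
      linear_combination hKt - hKs
    have hK' : 2 * K - Real.sin θ ^ 2 = 0 :=
      (mul_eq_zero.mp h).resolve_left (mul_ne_zero (sub_ne_zero.mpr hst.ne') hcos)
    have hprod : Real.sin θ * Real.cos θ = 0 := by
      linear_combination hKs - (c₁ + s * Real.cos θ) * hK'
    have hsin := (mul_eq_zero.mp hprod).resolve_right hcos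
    refine ⟨hsin, ?_⟩
    rw [hsin] at hK'
    linarith
end

section
/- Let r > 0 and c₁, c₂ ∈ ℝ, and define x(s) = c₁ + r·cos(s/r), z(s) = c₂ + r·sin(s/r). Let I ⊆ ℝ be an open interval containing more than one point with x(s) > 0 for all s ∈ I. Then there is no constant K ∈ ℝ such that 2K·x(s) = (2z'(s) − x(s)x'(s))·(x'(s)z''(s) − z'(s)x''(s)) + z'(s)·(x(s)z'(s) − x'(s)) for all s ∈ I. -/
/-- For analytic `P`, the function `P (cos t) + (a + 2 cos t) sin t` of `t = s / r` vanishes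
identically on no nonempty open interval. -/
theorem not_forall_mem_Ioo_cos_add_sin_eq_zero {p q r : ℝ} (hpq : p < q) (hr : r ≠ 0)
    (P : ℝ → ℝ) (hP : AnalyticOnNhd ℝ P Set.univ) (a : ℝ) :
    ¬ ∀ s ∈ Set.Ioo p q,
      P (Real.cos (s / r)) + (a + 2 * Real.cos (s / r)) * Real.sin (s / r) = 0 := by
  intro h
  let f : ℝ → ℝ := fun s =>
    P (Real.cos (s / r)) + (a + 2 * Real.cos (s / r)) * Real.sin (s / r)
  have hdiv (s : ℝ) : AnalyticAt ℝ (fun s : ℝ => s / r) s := by fun_prop (disch := exact hr)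
  have hcos (s : ℝ) : AnalyticAt ℝ (fun s : ℝ => Real.cos (s / r)) s :=
    AnalyticAt.fun_comp (g := Real.cos) Real.analyticAt_cos (hdiv s)
  have hsin (s : ℝ) : AnalyticAt ℝ (fun s : ℝ => Real.sin (s / r)) s :=
    AnalyticAt.fun_comp (g := Real.sin) Real.analyticAt_sin (hdiv s)
  have hf : AnalyticOnNhd ℝ f Set.univ := fun s _ =>
    ((hP _ (Set.mem_univ _)).comp (hcos s)).add
      ((analyticAt_const.add (analyticAt_const.mul (hcos s))).mul (hsin s))
  obtain ⟨m, hm⟩ := Set.nonempty_Ioo.2 hpq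
  have hev : f =ᶠ[nhds m] 0 :=
    Filter.eventually_of_mem (isOpen_Ioo.mem_nhds hm) h
  have hf0 : f = 0 := hf.eq_of_eventuallyEq (fun _ _ => analyticAt_const) hev
  have key (t : ℝ) : P (Real.cos t) + (a + 2 * Real.cos t) * Real.sin t = 0 := by
    simpa [f, mul_div_cancel_left₀ t hr] using congrFun hf0 (r * t)
  have odd (t : ℝ) : (a + 2 * Real.cos t) * Real.sin t = 0 := by
    have h₁ := key t
    have h₂ := key (-t)
    rw [Real.cos_neg, Real.sin_neg] at h₂
    linarith
  have ha : a = 0 := by simpa using odd (Real.pi / 2)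
  have h₄ := odd (Real.pi / 4)
  simp [ha] at h₄

theorem deriv_const_add_mul_cos_div (r c : ℝ) (hr : r ≠ 0) :
    deriv (fun s => c + r * Real.cos (s / r)) = fun s => -Real.sin (s / r) := by
  funext s
  simp [mul_comm, hr]

theorem deriv_const_add_mul_sin_div (r c : ℝ) (hr : r ≠ 0) :
    deriv (fun s => c + r * Real.sin (s / r)) = fun s => Real.cos (s / r) := by
  funext s
  simp [mul_comm, hr]

theorem generating_curve_cannot_be_circle
    (r c₁ c₂ : ℝ) (hr : 0 < r) (x z : ℝ → ℝ)
    (hx : x = fun s => c₁ + r * Real.cos (s / r))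
    (hz : z = fun s => c₂ + r * Real.sin (s / r))
    (I : Set ℝ) (hI : ∃ p q : ℝ, p < q ∧ I = Set.Ioo p q)
    (hxpos : ∀ s ∈ I, 0 < x s) :
    ¬ ∃ K : ℝ, ∀ s ∈ I, 2 * K * x s =
      (2 * deriv z s - x s * deriv x s)
          * (deriv x s * deriv (deriv z) s - deriv z s * deriv (deriv x) s)
        + deriv z s * (x s * deriv z s - deriv x s) := by
  rintro ⟨K, hK⟩
  obtain ⟨p, q, hpq, rfl⟩ := hI
  have hr0 : r ≠ 0 := hr.ne'
  have hx₂ (s : ℝ) : deriv (fun s => -Real.sin (s / r)) s = -(Real.cos (s / r) / r) := by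
    simp [div_eq_mul_inv]
  have hz₂ (s : ℝ) : deriv (fun s => Real.cos (s / r)) s = -(Real.sin (s / r) / r) := by
    simp [div_eq_mul_inv]
  refine not_forall_mem_Ioo_cos_add_sin_eq_zero hpq hr0
    (fun u => 2 * u / r + c₁ * u ^ 2 + r * u ^ 3 - 2 * K * (c₁ + r * u))
    (fun u _ => by fun_prop (disch := exact hr0)) (c₁ / r) fun s hs => ?_
  have h := hK s hs
  rw [hx, hz, deriv_const_add_mul_cos_div r c₁ hr0, deriv_const_add_mul_sin_div r c₂ hr0,
    hx₂, hz₂] at h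
  have hκ : -Real.sin (s / r) * -(Real.sin (s / r) / r)
      - Real.cos (s / r) * -(Real.cos (s / r) / r) = 1 / r := by
    rw [← Real.sin_sq_add_cos_sq (s / r)]
    ring
  beta_reduce at h
  rw [hκ] at h
  rw [h]
  field_simp
  ring
end

section
/- Let I ⊆ ℝ be an interval with 0 ∈ I and let z : ℝ → ℝ be twice differentiable on I with z'(0) = 0. Suppose that for all x ∈ I: (2z'(x) − x)·z''(x) = (x·√(1 + z'(x)²) + z'(x))·(1 + z'(x)²). Then for all x ∈ I: (2z'(x) − x)·z'(x) = (2·(√(1 + z'(x)²) − 1) + x²/2)·√(1 + z'(x)²). -/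
/-- The derivative of the first integral of `(2p - x)p' = (x√(1 + p²) + p)(1 + p²)` along a
solution vanishes. -/
lemma hasDerivAt_first_integral_zero {p : ℝ → ℝ} {q x : ℝ} (hp : HasDerivAt p q x)
    (hode : (2 * p x - x) * q =
      (x * Real.sqrt (1 + (p x) ^ 2) + p x) * (1 + (p x) ^ 2)) :
    HasDerivAt (fun t => (2 * p t - t) * p t / Real.sqrt (1 + (p t) ^ 2)
      - (2 * (Real.sqrt (1 + (p t) ^ 2) - 1) + t ^ 2 / 2)) 0 x := by
  have hpos : 0 < 1 + (p x) ^ 2 := by positivity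
  have hw : HasDerivAt (fun t => Real.sqrt (1 + (p t) ^ 2))
      (p x * q / Real.sqrt (1 + (p x) ^ 2)) x := by
    convert ((hp.fun_pow 2).const_add 1).sqrt hpos.ne' using 1
    field_simp
    norm_num
    ring
  have hw0 : Real.sqrt (1 + (p x) ^ 2) ≠ 0 := (Real.sqrt_pos.2 hpos).ne'
  have hsq : Real.sqrt (1 + (p x) ^ 2) ^ 2 = 1 + (p x) ^ 2 := Real.sq_sqrt hpos.le
  refine (((((hp.const_mul 2).fun_sub (hasDerivAt_id' x)).fun_mul hp).fun_div hw hw0).fun_sub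
    (((hw.sub_const 1).const_mul 2).fun_add (((hasDerivAt_id' x).fun_pow 2).div_const 2))).congr_deriv ?_
  generalize Real.sqrt (1 + (p x) ^ 2) = w at *
  rw [← hsq] at hode
  field_simp
  push_cast
  linear_combination 2 * hode + (4 * p x * q - 2 * x * q) * hsq

theorem first_integral_for_curves_meeting_axis
    (I : Set ℝ) (hI : I.OrdConnected) (h0 : (0 : ℝ) ∈ I)
    (z : ℝ → ℝ)
    (hz : ∀ x ∈ I, DifferentiableAt ℝ z x ∧ DifferentiableAt ℝ (deriv z) x)
    (hz0 : deriv z 0 = 0)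
    (hode : ∀ x ∈ I, (2 * deriv z x - x) * deriv (deriv z) x =
      (x * Real.sqrt (1 + (deriv z x) ^ 2) + deriv z x) * (1 + (deriv z x) ^ 2)) :
    ∀ x ∈ I, (2 * deriv z x - x) * deriv z x =
      (2 * (Real.sqrt (1 + (deriv z x) ^ 2) - 1) + x ^ 2 / 2)
        * Real.sqrt (1 + (deriv z x) ^ 2) := by
  intro x hx
  have hd : ∀ t ∈ I, HasDerivWithinAt (fun t => (2 * deriv z t - t) * deriv z t /
      Real.sqrt (1 + (deriv z t) ^ 2)
      - (2 * (Real.sqrt (1 + (deriv z t) ^ 2) - 1) + t ^ 2 / 2)) 0 I t := fun t ht =>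
    (hasDerivAt_first_integral_zero (hz t ht).2.hasDerivAt (hode t ht)).hasDerivWithinAt
  have hconst := hI.convex.norm_image_sub_le_of_norm_hasDerivWithin_le hd
    (C := 0) (fun t _ => by simp) h0 hx
  have hw : Real.sqrt (1 + (deriv z x) ^ 2) ≠ 0 := (Real.sqrt_pos.2 (by positivity)).ne'
  simp only [hz0, zero_mul, norm_le_zero_iff] at hconst
  norm_num at hconst
  rw [← div_eq_iff hw]
  linarith
end

section
/- There exist ε > 0 and a function z : ℝ → ℝ differentiable on (−ε, ε) with z'(0) = 0 such that for all x ∈ (−ε, ε): (4x² − (x² − 4)²)·z'(x)² + 16·x·z'(x) + 16 − (x² − 4)² = 0. -/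
/-- Every continuous real function on the line has an antiderivative. -/
lemma Continuous.exists_forall_hasDerivAt {f : ℝ → ℝ} (hf : Continuous f) :
    ∃ F : ℝ → ℝ, ∀ x, HasDerivAt F (f x) x :=
  ⟨fun x => ∫ t in (0 : ℝ)..x, f t, fun x => hf.integral_hasStrictDerivAt 0 x |>.hasDerivAt⟩

theorem exists_rotational_surface_meeting_axis_orthogonally :
    ∃ ε : ℝ, 0 < ε ∧ ∃ z : ℝ → ℝ,
      (∀ x ∈ Set.Ioo (-ε) ε, DifferentiableAt ℝ z x) ∧
      deriv z 0 = 0 ∧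
      ∀ x ∈ Set.Ioo (-ε) ε,
        (4 * x ^ 2 - (x ^ 2 - 4) ^ 2) * (deriv z x) ^ 2 + 16 * x * deriv z x
          + 16 - (x ^ 2 - 4) ^ 2 = 0 := by
  -- The quadratic in `deriv z x` has discriminant `4 * x ^ 2 * (64 - (8 - x ^ 2) * A)`, with `A` its
  -- leading coefficient, so its roots are continuous in `x`. Truncating `A` at `-1` in the
  -- denominator makes the chosen root continuous on the whole line.
  have hf : Continuous fun x : ℝ =>
      x * (-8 + √(64 - (8 - x ^ 2) * (4 * x ^ 2 - (x ^ 2 - 4) ^ 2))) /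
        min (4 * x ^ 2 - (x ^ 2 - 4) ^ 2) (-1) := by
    refine Continuous.div (by fun_prop) (by fun_prop) fun x => ?_
    exact ((min_le_right _ _).trans_lt (by norm_num)).ne
  obtain ⟨z, hz⟩ := hf.exists_forall_hasDerivAt
  refine ⟨1 / 2, by norm_num, z, fun x _ => (hz x).differentiableAt, by simp [(hz 0).deriv], ?_⟩
  rintro x ⟨hx₁, hx₂⟩
  have hx : x ^ 2 < 1 / 4 := by nlinarith
  have hA : 4 * x ^ 2 - (x ^ 2 - 4) ^ 2 ≤ -1 := by nlinarith [sq_nonneg x]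
  rw [(hz x).deriv, min_eq_left hA]
  have hB : 0 ≤ 64 - (8 - x ^ 2) * (4 * x ^ 2 - (x ^ 2 - 4) ^ 2) := by nlinarith
  have hs := Real.sq_sqrt hB
  set s := √(64 - (8 - x ^ 2) * (4 * x ^ 2 - (x ^ 2 - 4) ^ 2))
  have hC : 16 - (x ^ 2 - 4) ^ 2 = x ^ 2 * (8 - x ^ 2) := by ring
  rw [add_sub_assoc, hC]
  generalize 4 * x ^ 2 - (x ^ 2 - 4) ^ 2 = A at hA hs ⊢
  have hA₀ : A ≠ 0 := by linarith
  field_simp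
  linear_combination x ^ 2 * hs
end

section
/- Let K > 0, set a = √(2K), let I ⊆ ℝ be an open interval containing 0, and let z : ℝ → ℝ be twice differentiable on I with z(0) = 0, z'(0) = 0 and z''(s) = z'(s)² − 2K for all s ∈ I. Then z(s) = −log(cosh(a·s)) for all s ∈ I. -/
/-- A first integral of the linear equation `w'' = c² w` on an open connected set. -/
theorem add_mul_eq_exp_of_hasDerivAt {I : Set ℝ} (hIo : IsOpen I) (hIc : IsPreconnected I)
    (h0 : (0 : ℝ) ∈ I) {w v : ℝ → ℝ} {c : ℝ} (hw : ∀ s ∈ I, HasDerivAt w (v s) s)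
    (hv : ∀ s ∈ I, HasDerivAt v (c ^ 2 * w s) s) {s : ℝ} (hs : s ∈ I) :
    v s + c * w s = (v 0 + c * w 0) * Real.exp (c * s) := by
  have hd : ∀ t ∈ I, HasDerivAt (fun t => (v t + c * w t) * Real.exp (-(c * t))) 0 t := by
    intro t ht
    have he : HasDerivAt (fun t => Real.exp (-(c * t))) (Real.exp (-(c * t)) * -(c * 1)) t :=
      ((hasDerivAt_id t).const_mul c).neg.exp
    exact (((hv t ht).add ((hw t ht).const_mul c)).mul he).congr_deriv
      (by simp only [Pi.add_apply]; ring)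
  have h := hIo.is_const_of_deriv_eq_zero hIc
    (fun t ht => (hd t ht).differentiableAt.differentiableWithinAt)
    (fun t ht => (hd t ht).deriv) hs h0
  simp only [mul_zero, neg_zero, Real.exp_zero, mul_one] at h
  rw [← h, mul_assoc, ← Real.exp_add, neg_add_cancel, Real.exp_zero, mul_one]

theorem uniqueness_positive_curvature_ode (K : ℝ) (hK : 0 < K)
    (a : ℝ) (ha : a = Real.sqrt (2 * K))
    (I : Set ℝ) (hI : ∃ p q : ℝ, p < q ∧ I = Set.Ioo p q) (h0 : (0 : ℝ) ∈ I)
    (z : ℝ → ℝ)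
    (hz : ∀ s ∈ I, DifferentiableAt ℝ z s ∧ DifferentiableAt ℝ (deriv z) s)
    (hz0 : z 0 = 0) (hz0' : deriv z 0 = 0)
    (hode : ∀ s ∈ I, deriv (deriv z) s = (deriv z s) ^ 2 - 2 * K) :
    ∀ s ∈ I, z s = -Real.log (Real.cosh (a * s)) := by
  intro s hs
  obtain ⟨p, q, -, rfl⟩ := hI
  have ha0 : 0 < a := ha ▸ Real.sqrt_pos.2 (by positivity)
  have ha2 : a ^ 2 = 2 * K := ha ▸ Real.sq_sqrt (by positivity)
  have hw : ∀ t ∈ Set.Ioo p q, HasDerivAt (fun t => Real.exp (-z t))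
      (Real.exp (-z t) * -deriv z t) t :=
    fun t ht => (hz t ht).1.hasDerivAt.neg.exp
  have hv : ∀ t ∈ Set.Ioo p q, HasDerivAt (fun t => Real.exp (-z t) * -deriv z t)
      (a ^ 2 * Real.exp (-z t)) t := by
    intro t ht
    refine ((hw t ht).mul (hz t ht).2.hasDerivAt.neg).congr_deriv ?_
    simp only [Pi.neg_apply]
    rw [hode t ht, ha2]
    ring
  have h1 := add_mul_eq_exp_of_hasDerivAt isOpen_Ioo isPreconnected_Ioo h0 hw hv hs
  have h2 := add_mul_eq_exp_of_hasDerivAt (c := -a) isOpen_Ioo isPreconnected_Ioo h0 hw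
    (by simpa only [neg_sq] using hv) hs
  simp only [hz0, hz0', neg_zero, Real.exp_zero, mul_zero, mul_one, zero_add, neg_mul] at h1 h2
  have h : Real.exp (-z s) = Real.cosh (a * s) := by
    rw [Real.cosh_eq]
    refine mul_left_cancel₀ ha0.ne' ?_
    linarith
  rw [← h, Real.log_exp, neg_neg]
end

section
/- Let K < 0, set a = √(−2K), let I ⊆ (−π/(2a), π/(2a)) be an open interval containing 0, and let z : ℝ → ℝ be twice differentiable on I with z(0) = 0, z'(0) = 0 and z''(s) = z'(s)² − 2K for all s ∈ I. Then z(s) = −log(cos(a·s)) for all s ∈ I. -/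
/-- On an open interval around `0`, the only solution of `w'' = -a² w` with `w 0 = 1` and
`w' 0 = 0` is `s ↦ cos (a * s)`. -/
theorem eq_cos_of_hasDerivAt {a : ℝ} (ha : a ≠ 0) {I : Set ℝ} (hI : IsOpen I)
    (hconn : IsPreconnected I) (h0 : (0 : ℝ) ∈ I) {w u : ℝ → ℝ}
    (hw : ∀ s ∈ I, HasDerivAt w (u s) s) (hu : ∀ s ∈ I, HasDerivAt u (-a ^ 2 * w s) s)
    (hw0 : w 0 = 1) (hu0 : u 0 = 0) {s : ℝ} (hs : s ∈ I) : w s = Real.cos (a * s) := by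
  have hcos (t : ℝ) : HasDerivAt (fun x => Real.cos (a * x)) (-Real.sin (a * t) * a) t := by
    simpa using ((hasDerivAt_id t).const_mul a).cos
  have hsin (t : ℝ) : HasDerivAt (fun x => Real.sin (a * x)) (Real.cos (a * t) * a) t := by
    simpa using ((hasDerivAt_id t).const_mul a).sin
  have const {f : ℝ → ℝ} (hf : ∀ t ∈ I, HasDerivAt f 0 t) : f s = f 0 :=
    hI.is_const_of_deriv_eq_zero hconn
      (fun t ht => (hf t ht).differentiableAt.differentiableWithinAt)
      (fun t ht => (hf t ht).deriv) hs h0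
  have hA := const (f := fun t => a * (w t * Real.cos (a * t)) - u t * Real.sin (a * t))
    fun t ht => ((((hw t ht).mul (hcos t)).const_mul a).sub ((hu t ht).mul (hsin t))).congr_deriv
      (by ring)
  have hB := const (f := fun t => a * (w t * Real.sin (a * t)) + u t * Real.cos (a * t))
    fun t ht => ((((hw t ht).mul (hsin t)).const_mul a).add ((hu t ht).mul (hcos t))).congr_deriv
      (by ring)
  simp only [hw0, hu0, mul_zero, Real.cos_zero, Real.sin_zero, mul_one, sub_zero,
    add_zero] at hA hB
  apply mul_left_cancel₀ ha
  linear_combination Real.cos (a * s) * hA + Real.sin (a * s) * hB -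
    a * w s * Real.sin_sq_add_cos_sq (a * s)

theorem uniqueness_negative_curvature_ode (K : ℝ) (hK : K < 0)
    (a : ℝ) (ha : a = Real.sqrt (-(2 * K)))
    (I : Set ℝ) (hI : ∃ p q : ℝ, p < q ∧ I = Set.Ioo p q)
    (hIsub : I ⊆ Set.Ioo (-(Real.pi / (2 * a))) (Real.pi / (2 * a)))
    (h0 : (0 : ℝ) ∈ I)
    (z : ℝ → ℝ)
    (hz : ∀ s ∈ I, DifferentiableAt ℝ z s ∧ DifferentiableAt ℝ (deriv z) s)
    (hz0 : z 0 = 0) (hz0' : deriv z 0 = 0)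
    (hode : ∀ s ∈ I, deriv (deriv z) s = (deriv z s) ^ 2 - 2 * K) :
    ∀ s ∈ I, z s = -Real.log (Real.cos (a * s)) := by
  intro s hs
  obtain ⟨p, q, -, rfl⟩ := hI
  have hasq : a ^ 2 = -(2 * K) := by rw [ha, Real.sq_sqrt (by linarith)]
  have ha0 : a ≠ 0 := by rw [ha]; exact (Real.sqrt_pos.2 (by linarith)).ne'
  have hw (t : ℝ) (ht : t ∈ Set.Ioo p q) :
      HasDerivAt (fun x => Real.exp (-z x)) (Real.exp (-z t) * -deriv z t) t :=
    (hz t ht).1.hasDerivAt.neg.exp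
  have key : Real.exp (-z s) = Real.cos (a * s) :=
    eq_cos_of_hasDerivAt ha0 isOpen_Ioo isPreconnected_Ioo h0 hw
      (fun t ht => ((hw t ht).mul (hz t ht).2.hasDerivAt.neg).congr_deriv <| by
        rw [hode t ht, hasq]
        simp only [Pi.neg_apply]
        ring)
      (by simp [hz0]) (by simp [hz0']) hs
  rw [← key, Real.log_exp, neg_neg]
end
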